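/- Let N ≥ 1, let A be an N×N Hermitian complex matrix, and let S be any real-valued function on the set of density matrices satisfying 0 ≤ S(ρ) ≤ C for some constant C and all density matrices ρ. Then, as β → ∞, the infimum over density matrices ρ of Re Tr(ρ·A) − β⁻¹·S(ρ) converges to the infimum, over unitary matrices U ∈ U(N) and indices i, of the (real part of the) diagonal entry (U·A·U*)_{ii}. -/

import Mathlib

open Matrix Filter
open scoped ComplexOrder

lemma aux_ge {N : ℕ} (A ρ : Matrix (Fin N) (Fin N) ℂ) (hρ : ρ.PosSemidef) (ht : ρ.trace = 1)
    (m : ℝ) (hm : ∀ U ∈ Matrix.unitaryGroup (Fin N) ℂ, ∀ i, m ≤ ((U * A * star U) i i).re) :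
    m ≤ ((ρ * A).trace).re := by
  have h1 := hρ.1.spectral_theorem
  rw [Unitary.conjStarAlgAut_apply] at h1
  set V := hρ.1.eigenvectorUnitary with hV
  have h2 : (ρ * A).trace = ∑ i, (hρ.1.eigenvalues i : ℂ) *
      ((star (V : Matrix (Fin N) (Fin N) ℂ)) * A * (V : Matrix (Fin N) (Fin N) ℂ)) i i := by
    conv_lhs => rw [h1]
    rw [Matrix.mul_assoc, Matrix.mul_assoc, Matrix.trace_mul_comm, Matrix.mul_assoc, Matrix.trace]
    simp [Matrix.diagonal_mul, Matrix.mul_assoc]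
  have h3 : ∑ i, hρ.1.eigenvalues i = 1 := by
    have := hρ.1.trace_eq_sum_eigenvalues
    rw [ht] at this
    simpa using (congrArg Complex.re this).symm
  rw [h2, Complex.re_sum]
  calc m = ∑ i, hρ.1.eigenvalues i * m := by rw [← Finset.sum_mul, h3, one_mul]
    _ ≤ _ := by
      refine Finset.sum_le_sum fun i _ => ?_
      rw [Complex.re_ofReal_mul]
      refine mul_le_mul_of_nonneg_left ?_ (hρ.eigenvalues_nonneg i)
      have := hm (star (V : Matrix (Fin N) (Fin N) ℂ)) (star V).2 i
      simpa using this

lemma aux_ex {N : ℕ} (A U : Matrix (Fin N) (Fin N) ℂ) (hU : U ∈ Matrix.unitaryGroup (Fin N) ℂ)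
    (i : Fin N) : ∃ ρ : Matrix (Fin N) (Fin N) ℂ, ρ.PosSemidef ∧ ρ.trace = 1 ∧
      (ρ * A).trace = (U * A * star U) i i := by
  have hE : (Matrix.diagonal (Pi.single i (1 : ℂ))).PosSemidef :=
    Matrix.PosSemidef.diagonal (Pi.single_nonneg.2 zero_le_one)
  refine ⟨star U * Matrix.diagonal (Pi.single i (1 : ℂ)) * U,
    hE.conjTranspose_mul_mul_same U, ?_, ?_⟩
  · rw [Matrix.trace_mul_comm, ← Matrix.mul_assoc, (Matrix.mem_unitaryGroup_iff).1 hU]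
    simp [Matrix.trace]
  · rw [Matrix.mul_assoc, Matrix.mul_assoc, Matrix.trace_mul_comm, Matrix.mul_assoc, Matrix.trace]
    simp [Matrix.diagonal_mul, Pi.single_apply]

lemma aux_bdd {N : ℕ} (A : Matrix (Fin N) (Fin N) ℂ) :
    BddBelow {r : ℝ | ∃ U ∈ Matrix.unitaryGroup (Fin N) ℂ, ∃ i : Fin N,
        r = ((U * A * star U) i i).re} := by
  refine ⟨-(∑ k, ∑ j, ‖A j k‖), ?_⟩
  rintro r ⟨U, hU, i, rfl⟩
  refine neg_le_of_abs_le ((Complex.abs_re_le_norm _).trans ?_)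
  rw [Matrix.mul_apply]
  refine (norm_sum_le _ _).trans (Finset.sum_le_sum fun k _ => ?_)
  rw [norm_mul, Matrix.mul_apply]
  have h1 : ‖(star U) k i‖ ≤ 1 := entry_norm_bound_of_unitary (Unitary.star_mem hU) k i
  refine (mul_le_of_le_one_right (norm_nonneg _) h1).trans ?_
  refine (norm_sum_le _ _).trans (Finset.sum_le_sum fun j _ => ?_)
  rw [norm_mul]
  exact mul_le_of_le_one_left (norm_nonneg _) (entry_norm_bound_of_unitary hU i j)

/-- for a Hermitian `A` and any uniformly bounded nonnegative entropy
functional `S` on density matrices, the deformed trace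
`inf_ρ { Re Tr(ρ A) - β⁻¹ S(ρ) }` converges, as `β → ∞`, to the tropical trace
`inf_{U ∈ U(N)} inf_i Re (U A U*)_{ii}`. -/
theorem deformed_trace_tendsto_tropical_trace
    (N : ℕ) (hN : 1 ≤ N) (A : Matrix (Fin N) (Fin N) ℂ) (hA : A.IsHermitian)
    (S : Matrix (Fin N) (Fin N) ℂ → ℝ) (C : ℝ)
    (hS : ∀ ρ : Matrix (Fin N) (Fin N) ℂ, ρ.PosSemidef → ρ.trace = 1 →
      0 ≤ S ρ ∧ S ρ ≤ C) :
    Tendsto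
      (fun β : ℝ =>
        sInf ((fun ρ : Matrix (Fin N) (Fin N) ℂ => ((ρ * A).trace).re - β⁻¹ * S ρ) ''
          {ρ | ρ.PosSemidef ∧ ρ.trace = 1}))
      atTop
      (nhds (sInf {r : ℝ | ∃ U ∈ Matrix.unitaryGroup (Fin N) ℂ, ∃ i : Fin N,
        r = ((U * A * star U) i i).re})) := by
  set T := {r : ℝ | ∃ U ∈ Matrix.unitaryGroup (Fin N) ℂ, ∃ i : Fin N,
        r = ((U * A * star U) i i).re} with hT
  have hb : BddBelow T := aux_bdd A
  have hne : T.Nonempty := ⟨_, 1, one_mem _, ⟨0, hN⟩, rfl⟩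
  have hlow : ∀ β : ℝ, 0 < β → ∀ x ∈ ((fun ρ : Matrix (Fin N) (Fin N) ℂ =>
      ((ρ * A).trace).re - β⁻¹ * S ρ) '' {ρ | ρ.PosSemidef ∧ ρ.trace = 1}),
      sInf T - β⁻¹ * C ≤ x := by
    rintro β hβ x ⟨ρ, ⟨h1, h2⟩, rfl⟩
    have h3 := aux_ge A ρ h1 h2 (sInf T) (fun U hU i => csInf_le hb ⟨U, hU, i, rfl⟩)
    have h4 := mul_le_mul_of_nonneg_left (hS ρ h1 h2).2 (inv_pos.2 hβ).le
    simp only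
    linarith
  have hlim : Tendsto (fun β : ℝ => sInf T - β⁻¹ * C) atTop (nhds (sInf T)) := by
    simpa using tendsto_const_nhds.sub (tendsto_inv_atTop_zero.mul_const C)
  refine tendsto_of_tendsto_of_tendsto_of_le_of_le' hlim tendsto_const_nhds ?_ ?_
  · filter_upwards [eventually_gt_atTop 0] with β hβ
    obtain ⟨ρ, h1, h2, -⟩ := aux_ex A 1 (one_mem _) ⟨0, hN⟩
    exact le_csInf ⟨_, ρ, ⟨h1, h2⟩, rfl⟩ (hlow β hβ)
  · filter_upwards [eventually_gt_atTop 0] with β hβ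
    refine le_csInf hne ?_
    rintro r ⟨U, hU, i, rfl⟩
    obtain ⟨ρ, h1, h2, h3⟩ := aux_ex A U hU i
    refine (csInf_le ⟨_, hlow β hβ⟩ ⟨ρ, ⟨h1, h2⟩, rfl⟩).trans ?_
    have h4 := mul_nonneg (inv_pos.2 hβ).le (hS ρ h1 h2).1
    simp only [h3]
    linarith
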